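/- Let s ≥ 0 and β ∈ ℝ. There exists C > 0 (depending only on s and β) such that for all t, α ∈ ℝ, all M ≥ 1, and all measurable f, g : ℝ → ℂ with ‖f‖_{L²_s}, ‖g‖_{L²_s} < ∞: (i) the function F_N(ξ) = ∫_ℝ 1{M < |Φ_β(ξ, ξ₁, ξ − ξ₁) − α| ≤ 2M} · (iξ) · exp(i t Φ_β(ξ, ξ₁, ξ − ξ₁)) · f(ξ₁) · g(ξ − ξ₁) dξ₁ satisfies ‖F_N‖_{L²_s} ≤ C · M^{1/2} · ‖f‖_{L²_s} ‖g‖_{L²_s}; and (ii) the function F_I(ξ) = ∫_ℝ 1{M < |Φ_β(ξ, ξ₁, ξ − ξ₁) − α| ≤ 2M} · (iξ) · exp(i t Φ_β(ξ, ξ₁, ξ − ξ₁)) / (Φ_β(ξ, ξ₁, ξ − ξ₁) − α) · f(ξ₁) · g(ξ − ξ₁) dξ₁ satisfies ‖F_I‖_{L²_s} ≤ C · M^{−1/2} · ‖f‖_{L²_s} ‖g‖_{L²_s}. -/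

import Mathlib

open MeasureTheory

/-- The Kawahara modulation function. -/
noncomputable def Phi (β ξ ξ₁ ξ₂ : ℝ) : ℝ :=
  ξ₁ ^ 5 + ξ₂ ^ 5 - ξ ^ 5 + β * (ξ₁ ^ 3 + ξ₂ ^ 3 - ξ ^ 3)

/-- The weighted norm `‖f‖_{L²_s} = (∫ ⟨ξ⟩^{2s} |f(ξ)|² dξ)^{1/2}`, with `⟨ξ⟩^{2s} = (1+ξ²)^s`. -/
noncomputable def wnorm (s : ℝ) (f : ℝ → ℂ) : ℝ :=
  (∫ ξ : ℝ, (1 + ξ ^ 2) ^ s * ‖f ξ‖ ^ 2) ^ ((1 : ℝ) / 2)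

open scoped ENNReal

lemma kw_cs (f g : ℝ → ℝ≥0∞) (hf : Measurable f) (hg : Measurable g) :
    (∫⁻ x, f x * g x) ^ 2 ≤ (∫⁻ x, f x ^ 2) * ∫⁻ x, g x ^ 2 := by
  have h := ENNReal.lintegral_mul_le_Lp_mul_Lq (volume : Measure ℝ) (p := 2) (q := 2)
    (by constructor <;> norm_num) hf.aemeasurable hg.aemeasurable
  have h2 := pow_le_pow_left' h 2
  simp only [Pi.mul_apply] at h2
  refine h2.trans (le_of_eq ?_)
  rw [mul_pow]
  have e : ∀ z : ℝ≥0∞, (z ^ (1 / (2:ℝ))) ^ 2 = z := fun z => by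
    rw [← ENNReal.rpow_natCast, ← ENNReal.rpow_mul]; norm_num
  rw [e, e]
  simp

lemma kw_tonelli (F G : ℝ → ℝ≥0∞) (hF : Measurable F) (hG : Measurable G) :
    ∫⁻ ξ, ∫⁻ x, (F x * G (ξ - x)) ^ 2 = (∫⁻ x, F x ^ 2) * ∫⁻ x, G x ^ 2 := by
  rw [lintegral_lintegral_swap (by fun_prop)]
  have : ∀ x, ∫⁻ ξ, (F x * G (ξ - x)) ^ 2 = F x ^ 2 * ∫⁻ y, G y ^ 2 := by
    intro x
    simp_rw [mul_pow]
    rw [lintegral_const_mul _ (by fun_prop), lintegral_sub_right_eq_self (fun y => G y ^ 2) x]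
  simp_rw [this]
  rw [lintegral_mul_const _ (by fun_prop)]

lemma kw_tonelli' (F G : ℝ → ℝ≥0∞) (hF : Measurable F) (hG : Measurable G) :
    ∫⁻ x, ∫⁻ ξ, (F ξ * G (ξ - x)) ^ 2 = (∫⁻ x, F x ^ 2) * ∫⁻ x, G x ^ 2 := by
  rw [lintegral_lintegral_swap (by fun_prop)]
  have : ∀ ξ, ∫⁻ x, (F ξ * G (ξ - x)) ^ 2 = F ξ ^ 2 * ∫⁻ y, G y ^ 2 := by
    intro x
    simp_rw [mul_pow]
    rw [lintegral_const_mul _ (by fun_prop), lintegral_sub_left_eq_self (fun y => G y ^ 2) x]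
  simp_rw [this]
  rw [lintegral_mul_const _ (by fun_prop)]

lemma kw_part1 (k : ℝ → ℝ → ℝ≥0∞) (hk : Measurable (Function.uncurry k)) (B : ℝ≥0∞)
    (h : ∀ ξ, ∫⁻ x, k ξ x ^ 2 ≤ B)
    (F G : ℝ → ℝ≥0∞) (hF : Measurable F) (hG : Measurable G) :
    ∫⁻ ξ, (∫⁻ x, k ξ x * (F x * G (ξ - x))) ^ 2 ≤ B * ((∫⁻ x, F x ^ 2) * ∫⁻ x, G x ^ 2) := by
  rw [← kw_tonelli F G hF hG, ← lintegral_const_mul _ (by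
    apply Measurable.lintegral_prod_right'
      (f := fun p : ℝ × ℝ => (F p.2 * G (p.1 - p.2)) ^ 2)
    fun_prop)]
  refine lintegral_mono fun ξ => ?_
  have hk' : Measurable (k ξ) := hk.of_uncurry_left
  refine (kw_cs _ _ hk' (by fun_prop)).trans ?_
  gcongr
  exact h ξ

lemma kw_part2 (k : ℝ → ℝ → ℝ≥0∞) (hk : Measurable (Function.uncurry k)) (B : ℝ≥0∞)
    (h : ∀ x, ∫⁻ ξ, k ξ x ^ 2 ≤ B)
    (F G : ℝ → ℝ≥0∞) (hF : Measurable F) (hG : Measurable G) :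
    ∫⁻ ξ, (∫⁻ x, k ξ x * (F x * G (ξ - x))) ^ 2 ≤ B * ((∫⁻ x, F x ^ 2) * ∫⁻ x, G x ^ 2) := by
  set H : ℝ → ℝ≥0∞ := fun ξ => ∫⁻ x, k ξ x * (F x * G (ξ - x)) with hH
  have hkm : Measurable (fun p : ℝ × ℝ => k p.1 p.2) := hk
  have hHm : Measurable H := by
    apply Measurable.lintegral_prod_right'
      (f := fun p : ℝ × ℝ => k p.1 p.2 * (F p.2 * G (p.1 - p.2)))
    fun_prop
  refine le_of_forall_lt fun L hL => ?_
  obtain ⟨φ, hφ, hfin, hLt⟩ : ∃ φ : SimpleFunc ℝ NNReal, (∀ x, (φ x : ℝ≥0∞) ≤ H x ^ 2) ∧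
      ∫⁻ x, (φ x : ℝ≥0∞) < ∞ ∧ L < ∫⁻ x, (φ x : ℝ≥0∞) := by
    rw [lintegral_eq_nnreal] at hL
    simp_rw [lt_iSup_iff] at hL
    obtain ⟨φ₀, h0, h0L⟩ := hL
    have h0L' : L < ∫⁻ x, (φ₀ x : ℝ≥0∞) := by
      rw [← SimpleFunc.lintegral_eq_lintegral] at h0L
      exact h0L
    obtain ⟨φ, hφ, hfin, hLt⟩ := SimpleFunc.exists_lt_lintegral_simpleFunc_of_lt_lintegral h0L'
    exact ⟨φ, fun x => (ENNReal.coe_le_coe.2 (hφ x)).trans (h0 x), hfin, hLt⟩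
  refine hLt.trans_le ?_
  set h' : ℝ → ℝ≥0∞ := fun ξ => ((NNReal.sqrt (φ ξ) : NNReal) : ℝ≥0∞) with hh'
  have hm : Measurable h' := by
    have := φ.measurable
    fun_prop
  have hsq : ∀ ξ, h' ξ ^ 2 = φ ξ := fun ξ => by
    simp only [hh']
    rw [← ENNReal.coe_pow, NNReal.sq_sqrt]
  have hle : ∀ ξ, h' ξ ≤ H ξ := fun ξ => by
    have h1 : h' ξ ^ 2 ≤ H ξ ^ 2 := by rw [hsq]; exact hφ ξ
    exact (ENNReal.pow_le_pow_left_iff two_ne_zero).1 h1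
  have hphi : ∫⁻ ξ, (φ ξ : ℝ≥0∞) = ∫⁻ ξ, h' ξ ^ 2 := by simp_rw [hsq]
  rw [hphi] at hfin ⊢
  set S := ∫⁻ ξ, h' ξ ^ 2 with hS
  have h1 : S ≤ ∫⁻ ξ, h' ξ * H ξ := by
    refine lintegral_mono fun ξ => ?_
    rw [sq]; gcongr; exact hle ξ
  have h2 : ∫⁻ ξ, h' ξ * H ξ = ∫⁻ x, F x * ∫⁻ ξ, k ξ x * (h' ξ * G (ξ - x)) := by
    have : ∀ ξ, h' ξ * H ξ = ∫⁻ x, h' ξ * (k ξ x * (F x * G (ξ - x))) := fun ξ => by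
      have hk' : Measurable (k ξ) := hk.of_uncurry_left
      rw [lintegral_const_mul _ (by fun_prop)]
    simp_rw [this]
    rw [lintegral_lintegral_swap (by
      apply Measurable.aemeasurable
      change Measurable (fun p : ℝ × ℝ => h' p.1 * (k p.1 p.2 * (F p.2 * G (p.1 - p.2))))
      fun_prop)]
    refine lintegral_congr fun x => ?_
    have hk' : Measurable (fun ξ => k ξ x) := hk.of_uncurry_right
    rw [← lintegral_const_mul _ (by fun_prop)]
    refine lintegral_congr fun ξ => ?_
    ring
  have hJm : Measurable (fun x => ∫⁻ ξ, k ξ x * (h' ξ * G (ξ - x))) := by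
    apply Measurable.lintegral_prod_left'
      (f := fun p : ℝ × ℝ => k p.1 p.2 * (h' p.1 * G (p.1 - p.2)))
    fun_prop
  have h3 : ∫⁻ x, (∫⁻ ξ, k ξ x * (h' ξ * G (ξ - x))) ^ 2 ≤ B * (S * ∫⁻ x, G x ^ 2) := by
    rw [hS, ← kw_tonelli' h' G hm hG, ← lintegral_const_mul _ (by
      apply Measurable.lintegral_prod_left'
        (f := fun p : ℝ × ℝ => (h' p.1 * G (p.1 - p.2)) ^ 2)
      fun_prop)]
    refine lintegral_mono fun x => ?_
    have hk' : Measurable (fun ξ => k ξ x) := hk.of_uncurry_right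
    refine (kw_cs _ _ hk' (by fun_prop)).trans ?_
    gcongr
    exact h x
  have h4 : S * S ≤ S * (B * ((∫⁻ x, F x ^ 2) * ∫⁻ x, G x ^ 2)) := by
    calc S * S = S ^ 2 := (sq S).symm
      _ ≤ (∫⁻ ξ, h' ξ * H ξ) ^ 2 := by gcongr
      _ ≤ (∫⁻ x, F x ^ 2) * (B * (S * ∫⁻ x, G x ^ 2)) := by
        rw [h2]
        refine (kw_cs _ _ hF hJm).trans ?_
        gcongr
      _ = _ := by ring
  by_cases h0 : S = 0
  · rw [h0]; exact zero_le
  · exact (ENNReal.mul_le_mul_iff_right h0 hfin.ne).1 h4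

lemma kw_vol (S : Set ℝ) (φ : ℝ → ℝ) (α M c : ℝ) (hc : 0 < c)
    (h1 : ∀ a ∈ S, |φ a - α| ≤ 2 * M)
    (h2 : ∀ a ∈ S, ∀ b ∈ S, c * |a - b| ≤ |φ a - φ b|) :
    volume S ≤ ENNReal.ofReal (4 * M / c) := by
  refine (Real.volume_le_diam S).trans (Metric.ediam_le fun a ha b hb => ?_)
  rw [edist_dist, Real.dist_eq]
  apply ENNReal.ofReal_le_ofReal
  rw [le_div_iff₀ hc]
  have e1 := abs_le.1 (h1 a ha)
  have e2 := abs_le.1 (h1 b hb)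
  have e3 : |φ a - φ b| ≤ 4 * M := by rw [abs_le]; constructor <;> linarith
  nlinarith [h2 a ha b hb]

lemma kw_diff_x (β ξ y z : ℝ) :
    Phi β ξ y (ξ - y) - Phi β ξ z (ξ - z) =
      ξ * ((y - z) * ((y - ξ / 2) + (z - ξ / 2))) *
        (5 * ((y - ξ / 2) ^ 2 + (z - ξ / 2) ^ 2) + 5 * ξ ^ 2 / 2 + 3 * β) := by
  unfold Phi; ring

lemma kw_diff_xi (β x a b : ℝ) :
    Phi β a x (a - x) - Phi β b x (b - x) =
      -x * ((a - b) * (a + b - x)) *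
        (5 * (a * (a - x) + b * (b - x)) + 5 * x ^ 2 + 3 * β) := by
  unfold Phi; ring

/-- high frequency, away from the diagonal, one side -/
lemma kw_high (β α M ξ : ℝ) (hξ : 1 + 4 * |β| < |ξ|) (ε : ℝ) (hε : ε = 1 ∨ ε = -1) :
    volume {x : ℝ | |Phi β ξ x (ξ - x) - α| ≤ 2 * M ∧ |ξ| / 4 ≤ ε * (x - ξ / 2)} ≤
      ENNReal.ofReal (4 * M / (ξ ^ 4 / 2)) := by
  have hb := abs_nonneg β
  have hx0 : 0 < |ξ| := by linarith
  have hx4 : ξ ^ 4 = |ξ| ^ 4 := by rw [← abs_pow]; exact (abs_of_nonneg (by positivity)).symm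
  refine kw_vol _ (fun x => Phi β ξ x (ξ - x)) α M (ξ ^ 4 / 2) (by rw [hx4]; positivity)
    (fun a ha => ha.1) fun a ha b hb' => ?_
  have h1 := ha.2
  have h2 := hb'.2
  rw [kw_diff_x, abs_mul, abs_mul, abs_mul]
  have e1 : |ξ| / 2 ≤ |(a - ξ / 2) + (b - ξ / 2)| := by
    rcases hε with rfl | rfl
    · exact le_trans (by linarith) (le_abs_self _)
    · exact le_trans (by linarith) (neg_le_abs _)
  have e2 : |ξ| ^ 2 ≤ |5 * ((a - ξ / 2) ^ 2 + (b - ξ / 2) ^ 2) + 5 * ξ ^ 2 / 2 + 3 * β| := by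
    refine le_trans ?_ (le_abs_self _)
    rw [← sq_abs ξ]
    nlinarith [neg_abs_le β, sq_nonneg (a - ξ / 2), sq_nonneg (b - ξ / 2)]
  rw [hx4]
  calc |ξ| ^ 4 / 2 * |a - b| = |ξ| * (|a - b| * (|ξ| / 2)) * |ξ| ^ 2 := by ring
    _ ≤ _ := by gcongr

/-- low frequency, one side -/
lemma kw_low (β α M ξ : ℝ) (hξ : ξ ≠ 0) (ε : ℝ) (hε : ε = 1 ∨ ε = -1) :
    volume {x : ℝ | |Phi β ξ x (ξ - x) - α| ≤ 2 * M ∧ 1 + |β| ≤ ε * (x - ξ / 2)} ≤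
      ENNReal.ofReal (4 * M / |ξ|) := by
  have hb := abs_nonneg β
  have hx0 : 0 < |ξ| := abs_pos.2 hξ
  refine kw_vol _ (fun x => Phi β ξ x (ξ - x)) α M (|ξ|) hx0
    (fun a ha => ha.1) fun a ha b hb' => ?_
  have h1 := ha.2
  have h2 := hb'.2
  rw [kw_diff_x, abs_mul, abs_mul, abs_mul]
  have e1 : 1 ≤ |(a - ξ / 2) + (b - ξ / 2)| := by
    rcases hε with rfl | rfl
    · exact le_trans (by linarith) (le_abs_self _)
    · exact le_trans (by linarith) (neg_le_abs _)
  have hε2 : ε ^ 2 = 1 := by rcases hε with rfl | rfl <;> norm_num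
  have e3 : (1 + |β|) ^ 2 ≤ (a - ξ / 2) ^ 2 := by
    calc (1 + |β|) ^ 2 ≤ (ε * (a - ξ / 2)) ^ 2 := by gcongr
      _ = _ := by rw [mul_pow, hε2, one_mul]
  have e2 : 1 ≤ |5 * ((a - ξ / 2) ^ 2 + (b - ξ / 2) ^ 2) + 5 * ξ ^ 2 / 2 + 3 * β| := by
    refine le_trans ?_ (le_abs_self _)
    nlinarith [neg_abs_le β, sq_nonneg ξ, sq_nonneg (b - ξ / 2)]
  calc |ξ| * |a - b| = |ξ| * (|a - b| * 1) * 1 := by ring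
    _ ≤ _ := by gcongr

/-- the first constant -/
noncomputable def kwC1 (β : ℝ) : ℝ := 16 + 8 * (1 + 4 * |β|) + (2 * (1 + |β|)) * (1 + 4 * |β|) ^ 2

lemma kw_meas1 (β α M ξ : ℝ) (hM : 1 ≤ M) :
    ENNReal.ofReal (ξ ^ 2) * volume {x : ℝ | |Phi β ξ x (ξ - x) - α| ≤ 2 * M ∧
      (|ξ| ≤ 1 + 4 * |β| ∨ |ξ| / 4 ≤ |x - ξ / 2|)} ≤ ENNReal.ofReal (kwC1 β * M) := by
  have hb := abs_nonneg β
  by_cases h0 : ξ = 0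
  · simp [h0]
  have hx0 : 0 < |ξ| := abs_pos.2 h0
  by_cases hK : |ξ| ≤ 1 + 4 * |β|
  · have hsub : {x : ℝ | |Phi β ξ x (ξ - x) - α| ≤ 2 * M ∧
      (|ξ| ≤ 1 + 4 * |β| ∨ |ξ| / 4 ≤ |x - ξ / 2|)} ⊆
      ({x : ℝ | |Phi β ξ x (ξ - x) - α| ≤ 2 * M ∧ 1 + |β| ≤ 1 * (x - ξ / 2)} ∪
      {x : ℝ | |Phi β ξ x (ξ - x) - α| ≤ 2 * M ∧ 1 + |β| ≤ -1 * (x - ξ / 2)}) ∪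
      Set.Icc (ξ / 2 - (1 + |β|)) (ξ / 2 + (1 + |β|)) := by
      rintro x ⟨hx, -⟩
      by_cases h1 : 1 + |β| ≤ 1 * (x - ξ / 2)
      · exact Or.inl (Or.inl ⟨hx, h1⟩)
      by_cases h2 : 1 + |β| ≤ -1 * (x - ξ / 2)
      · exact Or.inl (Or.inr ⟨hx, h2⟩)
      exact Or.inr ⟨by linarith, by linarith⟩
    have hv := (measure_mono (μ := volume) hsub).trans ((measure_union_le _ _).trans
      (add_le_add ((measure_union_le _ _).trans (add_le_add
        (kw_low β α M ξ h0 1 (Or.inl rfl)) (kw_low β α M ξ h0 (-1) (Or.inr rfl))))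
        (le_of_eq Real.volume_Icc)))
    rw [← ENNReal.ofReal_add (by positivity) (by positivity),
      ← ENNReal.ofReal_add (by positivity) (by linarith)] at hv
    refine (mul_le_mul_right hv _).trans ?_
    rw [← ENNReal.ofReal_mul (by positivity)]
    apply ENNReal.ofReal_le_ofReal
    have e : ξ ^ 2 * (4 * M / |ξ| + 4 * M / |ξ| + (ξ / 2 + (1 + |β|) - (ξ / 2 - (1 + |β|))))
        = 8 * M * |ξ| + |ξ| ^ 2 * (2 * (1 + |β|)) := by
      rw [← sq_abs ξ]; field_simp; ring
    rw [e]
    have e1 : 8 * M * |ξ| ≤ 8 * M * (1 + 4 * |β|) := by gcongr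
    have e2 : |ξ| ^ 2 * (2 * (1 + |β|)) ≤ (1 + 4 * |β|) ^ 2 * (2 * (1 + |β|)) * M := by
      calc _ ≤ (1 + 4 * |β|) ^ 2 * (2 * (1 + |β|)) := by gcongr
        _ ≤ _ := le_mul_of_one_le_right (by positivity) hM
    unfold kwC1
    nlinarith
  · have hsub : {x : ℝ | |Phi β ξ x (ξ - x) - α| ≤ 2 * M ∧
      (|ξ| ≤ 1 + 4 * |β| ∨ |ξ| / 4 ≤ |x - ξ / 2|)} ⊆
      ({x : ℝ | |Phi β ξ x (ξ - x) - α| ≤ 2 * M ∧ |ξ| / 4 ≤ 1 * (x - ξ / 2)} ∪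
      {x : ℝ | |Phi β ξ x (ξ - x) - α| ≤ 2 * M ∧ |ξ| / 4 ≤ -1 * (x - ξ / 2)}) := by
      rintro x ⟨hx, h⟩
      have h' := h.resolve_left hK
      rcases le_abs.1 h' with h1 | h1
      · exact Or.inl ⟨hx, by linarith⟩
      · exact Or.inr ⟨hx, by linarith⟩
    have hK' := not_le.1 hK
    have hv := (measure_mono (μ := volume) hsub).trans ((measure_union_le _ _).trans (add_le_add
        (kw_high β α M ξ hK' 1 (Or.inl rfl)) (kw_high β α M ξ hK' (-1) (Or.inr rfl))))
    rw [← ENNReal.ofReal_add (by positivity) (by positivity)] at hv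
    refine (mul_le_mul_right hv _).trans ?_
    rw [← ENNReal.ofReal_mul (by positivity)]
    apply ENNReal.ofReal_le_ofReal
    have e : ξ ^ 2 * (4 * M / (ξ ^ 4 / 2) + 4 * M / (ξ ^ 4 / 2)) = 16 * M / ξ ^ 2 := by
      field_simp; ring
    rw [e]
    have h1 : 1 ≤ ξ ^ 2 := by rw [← sq_abs ξ]; nlinarith
    have e1 : 16 * M / ξ ^ 2 ≤ 16 * M := div_le_self (by positivity) h1
    have e2 : 0 ≤ (8 * (1 + 4 * |β|) + (2 * (1 + |β|)) * (1 + 4 * |β|) ^ 2) * M := by positivity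
    unfold kwC1
    nlinarith

lemma kw_meas2 (β α M x : ℝ) :
    ENNReal.ofReal (16 * x ^ 2) * volume {ξ : ℝ | |Phi β ξ x (ξ - x) - α| ≤ 2 * M ∧
      ¬ (|ξ| ≤ 1 + 4 * |β| ∨ |ξ| / 4 ≤ |x - ξ / 2|)} ≤ ENNReal.ofReal (205 * M) := by
  have hb := abs_nonneg β
  set S := {ξ : ℝ | |Phi β ξ x (ξ - x) - α| ≤ 2 * M ∧
      ¬ (|ξ| ≤ 1 + 4 * |β| ∨ |ξ| / 4 ≤ |x - ξ / 2|)} with hS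
  rcases S.eq_empty_or_nonempty with hE | ⟨ξ₀, hξ₀⟩
  · rw [hE]; simp
  -- basic facts
  have key : ∀ ξ ∈ S, 1 + 4 * |β| < |ξ| ∧ 4 * |x| ≤ 3 * |ξ| ∧ |ξ| ≤ 4 * |x| ∧ 0 < ξ * x := by
    rintro ξ ⟨-, h⟩
    rw [not_or, not_le, not_le] at h
    obtain ⟨h1, h2⟩ := h
    have h3 := abs_lt.1 h2
    refine ⟨h1, ?_⟩
    rcases le_total 0 ξ with h | h
    · rw [abs_of_nonneg h] at *
      have hx : 0 < x := by linarith
      rw [abs_of_pos hx]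
      exact ⟨by linarith, by linarith, mul_pos (by linarith) hx⟩
    · rw [abs_of_nonpos h] at *
      have hx : x < 0 := by linarith
      rw [abs_of_neg hx]
      exact ⟨by linarith, by linarith, mul_pos_of_neg_of_neg (by linarith) hx⟩
  have hk0 := key ξ₀ hξ₀
  have hx4 : 1 / 4 < |x| := by linarith [hk0.1, hk0.2.2.1]
  have hx2 : 1 / 16 ≤ x ^ 2 := by rw [← sq_abs x]; nlinarith
  have hM0 : 0 ≤ M := by linarith [abs_nonneg (Phi β ξ₀ x (ξ₀ - x) - α), hξ₀.1]
  have hv : volume S ≤ ENNReal.ofReal (4 * M / (5 * x ^ 4)) := by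
    refine kw_vol _ (fun ξ => Phi β ξ x (ξ - x)) α M _ (by
      have : x ^ 4 = (x ^ 2) ^ 2 := by ring
      rw [this]; positivity) (fun a ha => ha.1) fun a ha b hb' => ?_
    obtain ⟨a1, a2, a3, a4⟩ := key a ha
    obtain ⟨b1, b2, b3, b4⟩ := key b hb'
    rw [kw_diff_xi, abs_mul, abs_mul, abs_mul, abs_neg]
    have q : ∀ ξ, 1 + 4 * |β| < |ξ| → 4 * |x| ≤ 3 * |ξ| → 0 < ξ * x →
        1 / 4 + 2 * |β| ≤ ξ * (ξ - x) := by
      intro ξ h1 h2 h3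
      have h4 : ξ * x = |ξ| * |x| := by rw [← abs_mul, abs_of_pos h3]
      have h5 : ξ * (ξ - x) = |ξ| ^ 2 - |ξ| * |x| := by rw [sq_abs, ← h4]; ring
      rw [h5]
      nlinarith [abs_nonneg x]
    have e1 : |x| ≤ |a + b - x| := by
      rcases lt_or_gt_of_ne (show x ≠ 0 by rintro rfl; simp at hx4; linarith) with hx | hx
      · have ha0 : a < 0 := by nlinarith
        have hb0 : b < 0 := by nlinarith
        rw [abs_of_neg hx, abs_of_neg ha0] at a2
        rw [abs_of_neg hx, abs_of_neg hb0] at b2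
        rw [abs_of_neg hx]
        exact le_trans (by linarith) (neg_le_abs _)
      · have ha0 : 0 < a := by nlinarith
        have hb0 : 0 < b := by nlinarith
        rw [abs_of_pos hx, abs_of_pos ha0] at a2
        rw [abs_of_pos hx, abs_of_pos hb0] at b2
        rw [abs_of_pos hx]
        exact le_trans (by linarith) (le_abs_self _)
    have e2 : 5 * |x| ^ 2 ≤ |5 * (a * (a - x) + b * (b - x)) + 5 * x ^ 2 + 3 * β| := by
      refine le_trans ?_ (le_abs_self _)
      rw [sq_abs]
      linarith [q a a1 a2 a4, q b b1 b2 b4, neg_abs_le β]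
    have hx4 : x ^ 4 = |x| ^ 4 := by rw [← abs_pow]; exact (abs_of_nonneg (by positivity)).symm
    rw [hx4]
    calc 5 * |x| ^ 4 * |a - b| = |x| * (|a - b| * |x|) * (5 * |x| ^ 2) := by ring
      _ ≤ _ := by gcongr
  refine (mul_le_mul_right hv _).trans ?_
  rw [← ENNReal.ofReal_mul (by positivity)]
  apply ENNReal.ofReal_le_ofReal
  have hxne : x ≠ 0 := by rintro rfl; norm_num at hx2
  have e : 16 * x ^ 2 * (4 * M / (5 * x ^ 4)) = 64 / 5 * M / x ^ 2 := by field_simp; ring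
  rw [e, div_le_iff₀ (by positivity)]
  nlinarith

lemma kw_add_sq (a b : ℝ≥0∞) : (a + b) ^ 2 ≤ 2 * (a ^ 2 + b ^ 2) := by
  have h := ENNReal.rpow_add_le_mul_rpow_add_rpow a b (p := 2) (by norm_num)
  have e : (2 : ℝ) - 1 = 1 := by norm_num
  rw [e, ENNReal.rpow_one] at h
  simpa only [ENNReal.rpow_ofNat] using h

lemma kw_Phi_meas (β : ℝ) : Measurable (fun p : ℝ × ℝ => Phi β p.1 p.2 (p.1 - p.2)) := by
  unfold Phi; fun_prop

lemma kw_core (β α M : ℝ) (hM : 1 ≤ M) (F G : ℝ → ℝ≥0∞) (hF : Measurable F) (hG : Measurable G) :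
    ∫⁻ ξ, (∫⁻ x, (if |Phi β ξ x (ξ - x) - α| ≤ 2 * M then ENNReal.ofReal |ξ| else 0)
      * (F x * G (ξ - x))) ^ 2 ≤
    ENNReal.ofReal (2 * (kwC1 β + 205) * M) * ((∫⁻ x, F x ^ 2) * ∫⁻ x, G x ^ 2) := by
  classical
  have hPm := kw_Phi_meas β
  have hb := abs_nonneg β
  have hC1 : 0 ≤ kwC1 β := by unfold kwC1; positivity
  set R : ℝ → ℝ → Prop := fun ξ x => |ξ| ≤ 1 + 4 * |β| ∨ |ξ| / 4 ≤ |x - ξ / 2| with hR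
  set k1 : ℝ → ℝ → ℝ≥0∞ := fun ξ x =>
    if |Phi β ξ x (ξ - x) - α| ≤ 2 * M ∧ R ξ x then ENNReal.ofReal |ξ| else 0 with hk1
  set k2 : ℝ → ℝ → ℝ≥0∞ := fun ξ x =>
    if |Phi β ξ x (ξ - x) - α| ≤ 2 * M ∧ ¬ R ξ x then ENNReal.ofReal |ξ| else 0 with hk2
  have mA : MeasurableSet {p : ℝ × ℝ | |Phi β p.1 p.2 (p.1 - p.2) - α| ≤ 2 * M} :=
    measurableSet_le (by fun_prop) (by fun_prop)
  have mR : MeasurableSet {p : ℝ × ℝ | R p.1 p.2} :=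
    (measurableSet_le (f := fun p : ℝ × ℝ => |p.1|) (by fun_prop) (by fun_prop)).union
      (measurableSet_le (f := fun p : ℝ × ℝ => |p.1| / 4) (g := fun p : ℝ × ℝ => |p.2 - p.1 / 2|)
        (by fun_prop) (by fun_prop))
  have mk1 : Measurable (Function.uncurry k1) :=
    Measurable.ite (mA.inter mR) (by fun_prop) (by fun_prop)
  have mk2 : Measurable (Function.uncurry k2) :=
    Measurable.ite (mA.inter mR.compl) (by fun_prop) (by fun_prop)
  have b1 : ∀ ξ, ∫⁻ x, k1 ξ x ^ 2 ≤ ENNReal.ofReal (kwC1 β * M) := by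
    intro ξ
    refine le_trans (le_of_eq ?_) (kw_meas1 β α M ξ hM)
    have hm : MeasurableSet {x : ℝ | |Phi β ξ x (ξ - x) - α| ≤ 2 * M ∧ R ξ x} :=
      (mA.inter mR).preimage (f := fun x : ℝ => (ξ, x)) (by fun_prop)
    rw [← lintegral_indicator_const hm]
    refine lintegral_congr fun x => ?_
    simp only [hk1, Set.indicator, Set.mem_ofPred_eq]
    split_ifs
    · rw [← ENNReal.ofReal_pow (abs_nonneg _), sq_abs]
    · simp
  have b2 : ∀ x, ∫⁻ ξ, k2 ξ x ^ 2 ≤ ENNReal.ofReal (205 * M) := by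
    intro x
    refine le_trans ?_ (kw_meas2 β α M x)
    have hm : MeasurableSet {ξ : ℝ | |Phi β ξ x (ξ - x) - α| ≤ 2 * M ∧ ¬ R ξ x} :=
      (mA.inter mR.compl).preimage (f := fun ξ : ℝ => (ξ, x)) (by fun_prop)
    rw [← lintegral_indicator_const hm]
    refine lintegral_mono fun ξ => ?_
    simp only [hk2, Set.indicator, Set.mem_ofPred_eq]
    split_ifs with h
    · rw [← ENNReal.ofReal_pow (abs_nonneg _)]
      apply ENNReal.ofReal_le_ofReal
      have h2 := h.2
      simp only [hR, not_or, not_le] at h2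
      have h3 := abs_sub_abs_le_abs_sub (ξ / 2) x
      rw [abs_sub_comm, abs_div, abs_two] at h3
      have h4 : |ξ| ≤ 4 * |x| := by linarith
      calc |ξ| ^ 2 ≤ (4 * |x|) ^ 2 := by gcongr
        _ = 16 * x ^ 2 := by rw [mul_pow, sq_abs]; norm_num
    · simp
  have p1 := kw_part1 k1 mk1 _ b1 F G hF hG
  have p2 := kw_part2 k2 mk2 _ b2 F G hF hG
  have m1 : Measurable (fun ξ => ∫⁻ x, k1 ξ x * (F x * G (ξ - x))) := by
    have mk1' : Measurable (fun p : ℝ × ℝ => k1 p.1 p.2) := mk1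
    apply Measurable.lintegral_prod_right'
      (f := fun p : ℝ × ℝ => k1 p.1 p.2 * (F p.2 * G (p.1 - p.2)))
    fun_prop
  calc _ ≤ ∫⁻ ξ, (2 * (∫⁻ x, k1 ξ x * (F x * G (ξ - x))) ^ 2
            + 2 * (∫⁻ x, k2 ξ x * (F x * G (ξ - x))) ^ 2) := by
        refine lintegral_mono fun ξ => ?_
        have hk' : Measurable (k1 ξ) := mk1.of_uncurry_left
        have e : ∀ x, (if |Phi β ξ x (ξ - x) - α| ≤ 2 * M then ENNReal.ofReal |ξ| else 0)
            * (F x * G (ξ - x)) = k1 ξ x * (F x * G (ξ - x)) + k2 ξ x * (F x * G (ξ - x)) := by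
          intro x
          rw [← add_mul]
          congr 1
          simp only [hk1, hk2]
          by_cases hr : R ξ x <;> simp [hr]
        simp_rw [e]
        rw [lintegral_add_left (by fun_prop), ← mul_add]
        exact kw_add_sq _ _
    _ = 2 * (∫⁻ ξ, (∫⁻ x, k1 ξ x * (F x * G (ξ - x))) ^ 2)
          + 2 * ∫⁻ ξ, (∫⁻ x, k2 ξ x * (F x * G (ξ - x))) ^ 2 := by
        rw [lintegral_add_left (by fun_prop), lintegral_const_mul' _ _ (by simp),
          lintegral_const_mul' _ _ (by simp)]
    _ ≤ 2 * (ENNReal.ofReal (kwC1 β * M) * ((∫⁻ x, F x ^ 2) * ∫⁻ x, G x ^ 2)) +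
        2 * (ENNReal.ofReal (205 * M) * ((∫⁻ x, F x ^ 2) * ∫⁻ x, G x ^ 2)) := by gcongr
    _ = _ := by
        have : (2 : ℝ≥0∞) = ENNReal.ofReal 2 := by simp
        rw [this, ← mul_assoc (ENNReal.ofReal 2),
          ← mul_assoc (ENNReal.ofReal 2), ← add_mul, ← ENNReal.ofReal_mul (by norm_num),
          ← ENNReal.ofReal_mul (by norm_num), ← ENNReal.ofReal_add (by positivity) (by positivity)]
        congr 2
        ring

lemma kw_general (s β : ℝ) (hs : 0 ≤ s) (α M D : ℝ) (hM : 1 ≤ M) (hD : 0 ≤ D) (f g : ℝ → ℂ)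
    (hf : Measurable f) (hg : Measurable g)
    (hfi : Integrable (fun ξ : ℝ => (1 + ξ ^ 2) ^ s * ‖f ξ‖ ^ 2))
    (hgi : Integrable (fun ξ : ℝ => (1 + ξ ^ 2) ^ s * ‖g ξ‖ ^ 2))
    (T : ℝ → ℝ → ℂ)
    (hT : ∀ ξ x, ‖T ξ x‖ ≤ if |Phi β ξ x (ξ - x) - α| ≤ 2 * M then
      D * |ξ| * ‖f x‖ * ‖g (ξ - x)‖ else 0) :
    wnorm s (fun ξ => ∫ x, T ξ x) ≤
      (2 ^ s * (2 * (kwC1 β + 205))) ^ ((1 : ℝ) / 2) * (D * M ^ ((1 : ℝ) / 2))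
        * wnorm s f * wnorm s g := by
  have hb := abs_nonneg β
  have hC1 : 0 ≤ kwC1 β := by unfold kwC1; positivity
  have hM0 : 0 ≤ M := by linarith
  have hw : ∀ x : ℝ, 0 ≤ (1 + x ^ 2) ^ (s / 2) := fun x => by positivity
  have hws : ∀ x : ℝ, ((1 + x ^ 2) ^ (s / 2)) ^ 2 = (1 + x ^ 2) ^ s := fun x => by
    rw [← Real.rpow_natCast, ← Real.rpow_mul (by positivity)]; norm_num
  set F : ℝ → ℝ≥0∞ := fun x => ENNReal.ofReal ((1 + x ^ 2) ^ (s / 2) * ‖f x‖) with hFd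
  set G : ℝ → ℝ≥0∞ := fun x => ENNReal.ofReal ((1 + x ^ 2) ^ (s / 2) * ‖g x‖) with hGd
  have hF : Measurable F := by fun_prop
  have hG : Measurable G := by fun_prop
  have sq' : ∀ h : ℝ → ℂ, ∀ x : ℝ, ENNReal.ofReal ((1 + x ^ 2) ^ (s / 2) * ‖h x‖) ^ 2 =
      ENNReal.ofReal ((1 + x ^ 2) ^ s * ‖h x‖ ^ 2) := fun h x => by
    rw [← ENNReal.ofReal_pow (by positivity), mul_pow, hws]
  set A := ∫ ξ : ℝ, (1 + ξ ^ 2) ^ s * ‖f ξ‖ ^ 2 with hA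
  set B := ∫ ξ : ℝ, (1 + ξ ^ 2) ^ s * ‖g ξ‖ ^ 2 with hB
  have hA0 : 0 ≤ A := integral_nonneg fun x => by positivity
  have hB0 : 0 ≤ B := integral_nonneg fun x => by positivity
  have hFA : ∫⁻ x, F x ^ 2 = ENNReal.ofReal A := by
    rw [hA, ofReal_integral_eq_lintegral_ofReal hfi (ae_of_all _ fun x => by positivity)]
    exact lintegral_congr fun x => sq' f x
  have hGB : ∫⁻ x, G x ^ 2 = ENNReal.ofReal B := by
    rw [hB, ofReal_integral_eq_lintegral_ofReal hgi (ae_of_all _ fun x => by positivity)]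
    exact lintegral_congr fun x => sq' g x
  have hpt : ∀ ξ x, ENNReal.ofReal ((1 + ξ ^ 2) ^ (s / 2)) * ‖T ξ x‖ₑ ≤
      ENNReal.ofReal (2 ^ (s / 2) * D) *
      ((if |Phi β ξ x (ξ - x) - α| ≤ 2 * M then ENNReal.ofReal |ξ| else 0)
      * (F x * G (ξ - x))) := by
    intro ξ x
    have h1 := hT ξ x
    split_ifs with hc
    · rw [if_pos hc] at h1
      rw [← ofReal_norm, ← ENNReal.ofReal_mul (by positivity), hFd, hGd]
      simp only
      rw [← ENNReal.ofReal_mul (by positivity), ← ENNReal.ofReal_mul (by positivity),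
        ← ENNReal.ofReal_mul (by positivity)]
      apply ENNReal.ofReal_le_ofReal
      have h2 : (1 + ξ ^ 2) ^ (s / 2) ≤
          2 ^ (s / 2) * (1 + x ^ 2) ^ (s / 2) * (1 + (ξ - x) ^ 2) ^ (s / 2) := by
        rw [← Real.mul_rpow (by positivity) (by positivity),
          ← Real.mul_rpow (by positivity) (by positivity)]
        apply Real.rpow_le_rpow (by positivity) _ (by positivity)
        nlinarith [sq_nonneg (x * (ξ - x)), sq_nonneg (x - (ξ - x))]
      calc _ ≤ (2 ^ (s / 2) * (1 + x ^ 2) ^ (s / 2) * (1 + (ξ - x) ^ 2) ^ (s / 2)) *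
            (D * |ξ| * ‖f x‖ * ‖g (ξ - x)‖) := by gcongr
        _ = _ := by ring
    · rw [if_neg hc] at h1
      have : ‖T ξ x‖ₑ = 0 := by
        rw [← ofReal_norm]; exact ENNReal.ofReal_of_nonpos h1
      rw [this]; simp
  have hpt2 : ∀ ξ, ENNReal.ofReal ((1 + ξ ^ 2) ^ s * ‖∫ x, T ξ x‖ ^ 2) ≤
      ENNReal.ofReal (2 ^ s * D ^ 2) *
      (∫⁻ x, (if |Phi β ξ x (ξ - x) - α| ≤ 2 * M then ENNReal.ofReal |ξ| else 0)
      * (F x * G (ξ - x))) ^ 2 := by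
    intro ξ
    rw [← sq' (fun ξ => ∫ x, T ξ x) ξ]
    have e2 : (2 : ℝ) ^ s * D ^ 2 = (2 ^ (s / 2) * D) ^ 2 := by
      rw [mul_pow, ← Real.rpow_natCast (2 ^ (s / 2)), ← Real.rpow_mul (by positivity)]; norm_num
    rw [e2, ENNReal.ofReal_pow (by positivity), ← mul_pow]
    gcongr
    rw [ENNReal.ofReal_mul (by positivity), ofReal_norm]
    calc _ ≤ ENNReal.ofReal ((1 + ξ ^ 2) ^ (s / 2)) * ∫⁻ x, ‖T ξ x‖ₑ := by
          gcongr; exact enorm_integral_le_lintegral_enorm _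
      _ = ∫⁻ x, ENNReal.ofReal ((1 + ξ ^ 2) ^ (s / 2)) * ‖T ξ x‖ₑ :=
          (lintegral_const_mul' _ _ ENNReal.ofReal_ne_top).symm
      _ ≤ _ := lintegral_mono fun x => hpt ξ x
      _ = _ := lintegral_const_mul' _ _ ENNReal.ofReal_ne_top
  have hmain : ∫ ξ : ℝ, (1 + ξ ^ 2) ^ s * ‖∫ x, T ξ x‖ ^ 2 ≤
      2 ^ s * D ^ 2 * (2 * (kwC1 β + 205) * M * (A * B)) := by
    by_cases hint : Integrable (fun ξ : ℝ => (1 + ξ ^ 2) ^ s * ‖∫ x, T ξ x‖ ^ 2)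
    · rw [← ENNReal.ofReal_le_ofReal_iff (by positivity),
        ofReal_integral_eq_lintegral_ofReal hint (ae_of_all _ fun x => by positivity)]
      refine (lintegral_mono hpt2).trans ?_
      rw [lintegral_const_mul' _ _ ENNReal.ofReal_ne_top,
        ENNReal.ofReal_mul (p := 2 ^ s * D ^ 2) (by positivity)]
      refine mul_le_mul_right ((kw_core β α M hM F G hF hG).trans (le_of_eq ?_)) _
      rw [hFA, hGB, ← ENNReal.ofReal_mul hA0, ← ENNReal.ofReal_mul (by positivity)]
    · rw [integral_undef hint]; positivity
  unfold wnorm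
  rw [← hA, ← hB]
  have e : 2 ^ s * D ^ 2 * (2 * (kwC1 β + 205) * M * (A * B)) =
      (2 ^ s * (2 * (kwC1 β + 205))) * (D ^ 2 * M) * A * B := by ring
  refine (Real.rpow_le_rpow (integral_nonneg fun x => by positivity) hmain (by norm_num)).trans
    (le_of_eq ?_)
  rw [e, Real.mul_rpow (by positivity) hB0, Real.mul_rpow (by positivity) hA0,
    Real.mul_rpow (by positivity) (by positivity), Real.mul_rpow (by positivity) hM0]
  congr 4
  rw [← Real.sqrt_eq_rpow, Real.sqrt_sq hD]

/-- Dyadically localized estimates of Proposition 3.1: the operators `N^α_M` and `I^α_M`,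
localized to `M < |Φ_β − α| ≤ 2M`, satisfy
`‖N^α_M(f,g)‖_{H^s} ≲ M^{1/2} ‖f‖_{H^s} ‖g‖_{H^s}` and
`‖I^α_M(f,g)‖_{H^s} ≲ M^{−1/2} ‖f‖_{H^s} ‖g‖_{H^s}`. -/
theorem kawahara_dyadic_N_I_estimates (s β : ℝ) (hs : 0 ≤ s) :
    ∃ C > 0, ∀ (t α M : ℝ), 1 ≤ M → ∀ f g : ℝ → ℂ,
      Measurable f → Measurable g →
      Integrable (fun ξ : ℝ => (1 + ξ ^ 2) ^ s * ‖f ξ‖ ^ 2) →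
      Integrable (fun ξ : ℝ => (1 + ξ ^ 2) ^ s * ‖g ξ‖ ^ 2) →
      wnorm s (fun ξ : ℝ => ∫ ξ₁ : ℝ,
          if M < |Phi β ξ ξ₁ (ξ - ξ₁) - α| ∧ |Phi β ξ ξ₁ (ξ - ξ₁) - α| ≤ 2 * M then
            Complex.I * (ξ : ℂ) * Complex.exp (Complex.I * (t : ℂ) * ((Phi β ξ ξ₁ (ξ - ξ₁) : ℝ) : ℂ))
              * f ξ₁ * g (ξ - ξ₁)
          else 0)
        ≤ C * M ^ ((1 : ℝ) / 2) * wnorm s f * wnorm s g ∧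
      wnorm s (fun ξ : ℝ => ∫ ξ₁ : ℝ,
          if M < |Phi β ξ ξ₁ (ξ - ξ₁) - α| ∧ |Phi β ξ ξ₁ (ξ - ξ₁) - α| ≤ 2 * M then
            Complex.I * (ξ : ℂ)
              * (Complex.exp (Complex.I * (t : ℂ) * ((Phi β ξ ξ₁ (ξ - ξ₁) : ℝ) : ℂ))
                  / ((Phi β ξ ξ₁ (ξ - ξ₁) - α : ℝ) : ℂ))
              * f ξ₁ * g (ξ - ξ₁)
          else 0)
        ≤ C * M ^ (-(1 : ℝ) / 2) * wnorm s f * wnorm s g := by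
  have hb := abs_nonneg β
  have hC1 : 0 ≤ kwC1 β := by unfold kwC1; positivity
  refine ⟨(2 ^ s * (2 * (kwC1 β + 205))) ^ ((1 : ℝ) / 2), by positivity, ?_⟩
  intro t α M hM f g hf hg hfi hgi
  have hM0 : 0 < M := by linarith
  have hexp : ∀ r : ℝ, ‖Complex.exp (Complex.I * (t : ℂ) * (r : ℂ))‖ = 1 := fun r => by
    have : Complex.I * (t : ℂ) * (r : ℂ) = ((t * r : ℝ) : ℂ) * Complex.I := by push_cast; ring
    rw [this, Complex.norm_exp_ofReal_mul_I]
  constructor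
  · have h := kw_general s β hs α M 1 hM zero_le_one f g hf hg hfi hgi (fun ξ ξ₁ : ℝ =>
          if M < |Phi β ξ ξ₁ (ξ - ξ₁) - α| ∧ |Phi β ξ ξ₁ (ξ - ξ₁) - α| ≤ 2 * M then
            Complex.I * (ξ : ℂ) * Complex.exp (Complex.I * (t : ℂ) * ((Phi β ξ ξ₁ (ξ - ξ₁) : ℝ) : ℂ))
              * f ξ₁ * g (ξ - ξ₁)
          else 0) (fun ξ x => ?_)
    · rw [one_mul] at h
      exact h
    · by_cases h1 : M < |Phi β ξ x (ξ - x) - α| ∧ |Phi β ξ x (ξ - x) - α| ≤ 2 * M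
      · rw [if_pos h1, if_pos h1.2, norm_mul, norm_mul, norm_mul, norm_mul, hexp]
        simp
      · rw [if_neg h1, norm_zero]
        split_ifs <;> positivity
  · have h := kw_general s β hs α M M⁻¹ hM (by positivity) f g hf hg hfi hgi (fun ξ ξ₁ : ℝ =>
          if M < |Phi β ξ ξ₁ (ξ - ξ₁) - α| ∧ |Phi β ξ ξ₁ (ξ - ξ₁) - α| ≤ 2 * M then
            Complex.I * (ξ : ℂ)
              * (Complex.exp (Complex.I * (t : ℂ) * ((Phi β ξ ξ₁ (ξ - ξ₁) : ℝ) : ℂ))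
                  / ((Phi β ξ ξ₁ (ξ - ξ₁) - α : ℝ) : ℂ))
              * f ξ₁ * g (ξ - ξ₁)
          else 0) (fun ξ x => ?_)
    · have e : M⁻¹ * M ^ ((1 : ℝ) / 2) = M ^ (-(1 : ℝ) / 2) := by
        rw [← Real.rpow_neg_one, ← Real.rpow_add hM0]; norm_num
      rw [e] at h
      exact h
    · by_cases h1 : M < |Phi β ξ x (ξ - x) - α| ∧ |Phi β ξ x (ξ - x) - α| ≤ 2 * M
      · rw [if_pos h1, if_pos h1.2, norm_mul, norm_mul, norm_mul, norm_mul, norm_div, hexp]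
        rw [Complex.norm_I, Complex.norm_real, Complex.norm_real, one_mul, Real.norm_eq_abs,
          Real.norm_eq_abs, mul_comm |ξ|, one_div]
        gcongr
        exact h1.1.le
      · rw [if_neg h1, norm_zero]
        split_ifs <;> positivity
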